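/- Let λ = (l,μ,m) ∈ L₀^#, let γ and β be positive integers with β | m and gcd(β,γ) = 1. Then a((l,μ,m), γ) = a((βl, μ, m/β), γ). If moreover (1/β)·λ ∈ L₀^#, then a(λ, γ) = a((1/β)·λ, γ). -/

import Mathlib

open Matrix Complex

namespace OEis

/-- Extension of an even Gram matrix by a hyperbolic plane:
`[[0,0,1],[0,A,0],[1,0,0]]`. -/
def hyp {m : ℕ} (A : Matrix (Fin m) (Fin m) ℤ) :
    Matrix (Fin (m + 2)) (Fin (m + 2)) ℤ := fun i j =>
  if hi0 : (i : ℕ) = 0 then (if (j : ℕ) = m + 1 then 1 else 0)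
  else if him : (i : ℕ) = m + 1 then (if (j : ℕ) = 0 then 1 else 0)
  else if hj0 : (j : ℕ) = 0 then 0
  else if hjm : (j : ℕ) = m + 1 then 0
  else A ⟨(i : ℕ) - 1, by have := i.isLt; omega⟩ ⟨(j : ℕ) - 1, by have := j.isLt; omega⟩

variable (n : ℕ) (S : Matrix (Fin n) (Fin n) ℤ)

/-- `S₀ = [[0,0,1],[0,-S,0],[1,0,0]]`. -/
def MatS0 : Matrix (Fin (n + 2)) (Fin (n + 2)) ℤ := hyp (-S)

/-- `S₁ = [[0,0,1],[0,S₀,0],[1,0,0]]`. -/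
def MatS1 : Matrix (Fin (n + 4)) (Fin (n + 4)) ℤ := hyp (MatS0 n S)

/-- Bilinear form `uᵀ A v` over a field `K`. -/
def bilin {m : ℕ} (K : Type) [Field K] (A : Matrix (Fin m) (Fin m) ℤ)
    (u v : Fin m → K) : K :=
  u ⬝ᵥ (A.map (Int.cast : ℤ → K)).mulVec v

/-- Quadratic form `Q_A(v) = vᵀAv/2` over a field `K`. -/
def quadF {m : ℕ} (K : Type) [Field K] (A : Matrix (Fin m) (Fin m) ℤ)
    (v : Fin m → K) : K := bilin K A v v / 2

/-- First component of a vector. -/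
def vfirst {m : ℕ} {K : Type} (g : Fin (m + 2) → K) : K := g ⟨0, by omega⟩

/-- Last component of a vector. -/
def vlast {m : ℕ} {K : Type} (g : Fin (m + 2) → K) : K := g ⟨m + 1, by omega⟩

/-- Middle components of a vector. -/
def vmid {m : ℕ} {K : Type} (g : Fin (m + 2) → K) : Fin m → K :=
  fun i => g ⟨(i : ℕ) + 1, by have := i.isLt; omega⟩

/-- gcd of the entries of a rational vector (via numerators). -/
def ratGcd {m : ℕ} (v : Fin m → ℚ) : ℕ :=
  Finset.gcd Finset.univ fun i => (v i).num.natAbs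

/-- `v` has integral entries. -/
def inLat {m : ℕ} (v : Fin m → ℚ) : Prop := ∀ i, ∃ z : ℤ, v i = (z : ℚ)

/-- `g ∈ ℤ^m + c`. -/
def inLatShift {m : ℕ} (c g : Fin m → ℚ) : Prop := ∀ i, ∃ z : ℤ, g i - c i = (z : ℚ)

/-- Membership in the dual lattice `A⁻¹ℤ^m`, i.e. `Av` is integral. -/
def inDual {m : ℕ} (A : Matrix (Fin m) (Fin m) ℤ) (v : Fin m → ℚ) : Prop :=
  ∀ i, ∃ z : ℤ, ((A.map (Int.cast : ℤ → ℚ)).mulVec v) i = (z : ℚ)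

/-- The positive cone `P_S`. -/
def PosCone : Set (Fin (n + 2) → ℝ) :=
  {y | 0 < quadF ℝ (MatS0 n S) y ∧ 0 < y ⟨0, by omega⟩}

/-- The tube domain `H_S`. -/
def HS : Set (Fin (n + 2) → ℂ) :=
  {z | (fun i => (z i).im) ∈ PosCone n S}

/-- Automorphy factor attached to a vector:
`j(g,z) = -γ Q₀(z) + (d,z)₀ + δ` for `g = (δ,dᵀ,γ)ᵀ`. -/
noncomputable def jay (g : Fin (n + 4) → ℚ) (z : Fin (n + 2) → ℂ) : ℂ :=
  -((vlast g : ℚ) : ℂ) * quadF ℂ (MatS0 n S) z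
    + bilin ℂ (MatS0 n S) (fun i => ((vmid g i : ℚ) : ℂ)) z
    + ((vfirst g : ℚ) : ℂ)

/-- The index set of the Eisenstein series attached to a cusp `c`:
`{g ∈ L₁ + c : Q₁(g) = 0, gcd(S₁g) = 1}`. -/
def cuspSet (c : Fin (n + 4) → ℚ) : Set (Fin (n + 4) → ℚ) :=
  {g | inLatShift c g ∧ quadF ℚ (MatS1 n S) g = 0 ∧
    ratGcd (((MatS1 n S).map (Int.cast : ℤ → ℚ)).mulVec g) = 1}

/-- The standard-form cusp vector `(1, 0, 𝔠ᵀ, 0, Q(𝔠))ᵀ`. -/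
def stdCuspVec (fc : Fin n → ℚ) : Fin (n + 4) → ℚ := fun i =>
  if h0 : (i : ℕ) = 0 then 1
  else if h3 : (i : ℕ) = n + 3 then quadF ℚ S fc
  else if h12 : (i : ℕ) = 1 ∨ (i : ℕ) = n + 2 then 0
  else fc ⟨(i : ℕ) - 2, by have := i.isLt; omega⟩

/-- `c` is a standard-form cusp. -/
def IsStdCusp (c : Fin (n + 4) → ℚ) : Prop :=
  ∃ fc : Fin n → ℚ, inDual S fc ∧ (∃ z : ℤ, quadF ℚ S fc = (z : ℚ)) ∧
    c = stdCuspVec n S fc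

/-- The real orthogonal group of `A`. -/
def OSet {m : ℕ} (A : Matrix (Fin m) (Fin m) ℤ) : Set (Matrix (Fin m) (Fin m) ℝ) :=
  {M | Mᵀ * A.map (Int.cast : ℤ → ℝ) * M = A.map (Int.cast : ℤ → ℝ)}

/-- Connected component of the identity in the real orthogonal group. -/
def OPlus {m : ℕ} (A : Matrix (Fin m) (Fin m) ℤ) : Set (Matrix (Fin m) (Fin m) ℝ) :=
  connectedComponentIn (OSet A) 1

/-- `Γ_S`: integral matrices in `O⁺(S₁;ℝ)`. -/
def GammaS : Set (Matrix (Fin (n + 4)) (Fin (n + 4)) ℝ) :=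
  {M | M ∈ OPlus (MatS1 n S) ∧ ∀ i j, ∃ z : ℤ, M i j = (z : ℝ)}

/-- The discriminant kernel `Γ̃_S`. -/
def GammaTilde : Set (Matrix (Fin (n + 4)) (Fin (n + 4)) ℝ) :=
  {M | M ∈ GammaS n S ∧
    ∃ X : Matrix (Fin (n + 4)) (Fin (n + 4)) ℤ,
      M = 1 + (X * MatS1 n S).map (Int.cast : ℤ → ℝ)}

/-- Automorphy factor of a matrix: `j(M,z) = -γ Q₀(z) + (d,z)₀ + δ`
where `(γ, dᵀS₀, δ)` is the bottom row of `M`. -/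
noncomputable def jayM (M : Matrix (Fin (n + 4)) (Fin (n + 4)) ℝ)
    (z : Fin (n + 2) → ℂ) : ℂ :=
  -((M ⟨n + 3, by omega⟩ ⟨0, by omega⟩ : ℝ) : ℂ) * quadF ℂ (MatS0 n S) z
    + ∑ i : Fin (n + 2),
        ((M ⟨n + 3, by omega⟩ ⟨(i : ℕ) + 1, by have := i.isLt; omega⟩ : ℝ) : ℂ) * z i
    + ((M ⟨n + 3, by omega⟩ ⟨n + 3, by omega⟩ : ℝ) : ℂ)

/-- The action `M⟨z⟩ = (-Q₀(z)·b + Kz + c')·j(M,z)⁻¹`. -/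
noncomputable def actM (M : Matrix (Fin (n + 4)) (Fin (n + 4)) ℝ)
    (z : Fin (n + 2) → ℂ) : Fin (n + 2) → ℂ := fun i =>
  (-(quadF ℂ (MatS0 n S) z) *
      ((M ⟨(i : ℕ) + 1, by have := i.isLt; omega⟩ ⟨0, by omega⟩ : ℝ) : ℂ)
    + ∑ j : Fin (n + 2),
        ((M ⟨(i : ℕ) + 1, by have := i.isLt; omega⟩
            ⟨(j : ℕ) + 1, by have := j.isLt; omega⟩ : ℝ) : ℂ) * z j
    + ((M ⟨(i : ℕ) + 1, by have := i.isLt; omega⟩ ⟨n + 3, by omega⟩ : ℝ) : ℂ))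
  * (jayM n S M z)⁻¹

/-- The integral vector `(−Q₀(d)/γ, dᵀ, γ)ᵀ` built from `d` and `γ`. -/
def gExt (d : Fin (n + 2) → ℕ) (γ : ℕ) : Fin (n + 4) → ℚ := fun i =>
  if h0 : (i : ℕ) = 0 then -(quadF ℚ (MatS0 n S) fun j => (d j : ℚ)) / γ
  else if h3 : (i : ℕ) = n + 3 then (γ : ℚ)
  else (d ⟨(i : ℕ) - 1, by have := i.isLt; omega⟩ : ℚ)

open scoped Classical in
/-- The Dirichlet coefficient `a(λ,γ)`. -/
noncomputable def aCoef (lam : Fin (n + 2) → ℚ) (γ : ℕ) : ℂ :=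
  ∑ d ∈ Fintype.piFinset fun _ : Fin (n + 2) => Finset.range γ,
    if (∃ e : ℤ, quadF ℚ (MatS0 n S) (fun j => (d j : ℚ)) = (γ : ℚ) * e) ∧
        ratGcd (((MatS1 n S).map (Int.cast : ℤ → ℚ)).mulVec (gExt n S d γ)) = 1 then
      Complex.exp (2 * Real.pi * Complex.I *
        ((bilin ℚ (MatS0 n S) lam (fun j => (d j : ℚ)) / γ : ℚ) : ℂ))
    else 0

/-- The convolution `b(λ,γ) = Σ_{δ∣γ} a(λ,δ)`. -/
noncomputable def bCoef (lam : Fin (n + 2) → ℚ) (γ : ℕ) : ℂ :=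
  ∑ δ ∈ γ.divisors, aCoef n S lam δ

/-- The order/level of a rational vector: least `N ≥ 1` with `Nv` integral. -/
noncomputable def ordv {m : ℕ} (v : Fin m → ℚ) : ℕ :=
  sInf {N : ℕ | 0 < N ∧ ∀ i, ∃ z : ℤ, (N : ℚ) * v i = (z : ℚ)}

/-- `S` is `p`-maximal. -/
def pMaximal (p : ℕ) : Prop :=
  ∀ v : Fin n → ℚ, inDual S v → (∃ z : ℤ, quadF ℚ S v = (z : ℚ)) → ¬ p ∣ ordv v

/-- The vector `(l, μᵀ, m)ᵀ ∈ ℚ^{n+2}`. -/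
def asmVec (l : ℚ) (μ : Fin n → ℚ) (m : ℚ) : Fin (n + 2) → ℚ := fun i =>
  if h0 : (i : ℕ) = 0 then l
  else if h1 : (i : ℕ) = n + 1 then m
  else μ ⟨(i : ℕ) - 1, by have := i.isLt; omega⟩

open scoped Classical in
/-- The representation number `N(λ, p^ν, p^t)`. -/
noncomputable def Ncount (lam : Fin (n + 2) → ℚ) (p νl ν t : ℕ) : ℕ :=
  ((Fintype.piFinset fun _ : Fin n => Finset.range (p ^ ν)).filter fun v =>
    (∃ e : ℤ, quadF ℚ S (fun i => (v i : ℚ)) = (p : ℚ) ^ (t : ℕ) * e) ∧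
    (∃ e : ℤ, (p : ℚ) ^ ((νl : ℤ) - (t : ℤ)) * quadF ℚ S (fun i => (v i : ℚ))
        - bilin ℚ S (fun i => (v i : ℚ)) (vmid lam)
        + (p : ℚ) ^ ((t : ℤ) - (νl : ℤ)) * lam ⟨0, by omega⟩ * lam ⟨n + 1, by omega⟩
      = (p : ℚ) ^ (ν : ℕ) * e)).card

/-- `N*(λ,p^ν) = Σ_{t=0}^{min(ν,ν_λ)} N(λ,p^ν,p^t)`. -/
noncomputable def Nstar (lam : Fin (n + 2) → ℚ) (p νl ν : ℕ) : ℕ :=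
  ∑ t ∈ Finset.range (min ν νl + 1), Ncount n S lam p νl ν t

/-- Kloosterman sum `K(α,β;γ)` (with `β` allowed rational;
in all uses `β` is an integer). -/
noncomputable def kloos (α : ℤ) (β : ℚ) (γ : ℕ) : ℂ :=
  ∑ j ∈ Finset.range γ,
    if Nat.Coprime j γ then
      Complex.exp (2 * Real.pi * Complex.I *
        ((((α : ℚ) * j + β * ((((j : ZMod γ)⁻¹).val : ℕ) : ℚ)) / γ : ℚ) : ℂ))
    else 0

/-- `q ≡ 0 (mod p^k)` in `ℤ_p`, for a rational `q`. -/
def pCong (p k : ℕ) (q : ℚ) : Prop :=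
  q = 0 ∨ (k : ℤ) ≤ padicValRat p q

/-- The constant `c_{k,S}^• = (2π)^{2k-n/2}/(√(det S)·Γ(k)·Γ(k-n/2))`. -/
noncomputable def ckS (k : ℕ) : ℝ :=
  (2 * Real.pi) ^ ((2 * k : ℝ) - n / 2) /
    (Real.sqrt ((S.det : ℤ) : ℝ) * Real.Gamma (k : ℝ) * Real.Gamma ((k : ℝ) - n / 2))

end OEis

namespace OEis

section Periodic

theorem exists_inverse_mod {β γ : ℕ} (hγ : 0 < γ) (hco : Nat.Coprime β γ) :
    ∃ β' : ℕ, β' * β ≡ 1 [MOD γ] := by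
  have : NeZero γ := ⟨hγ.ne'⟩
  refine ⟨((β : ZMod γ)⁻¹).val, ?_⟩
  rw [← ZMod.natCast_eq_natCast_iff]
  push_cast
  rw [ZMod.natCast_zmod_val, mul_comm]
  exact ZMod.coe_mul_inv_eq_one β hco

/-- A sum over residues of a periodic function is invariant under scaling the coordinates by
units. -/
theorem sum_residues_scale {M : Type*} [AddCommMonoid M] {k γ : ℕ} (hγ : 0 < γ)
    {f : (Fin k → ℤ) → M}
    (hf : ∀ d v : Fin k → ℤ, f (d + (γ : ℤ) • v) = f d)
    {w w' : Fin k → ℕ} (hw : ∀ j, w' j * w j ≡ 1 [MOD γ]) :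
    ∑ d ∈ Fintype.piFinset fun _ : Fin k => Finset.range γ, f (fun j => (d j : ℤ))
      = ∑ d ∈ Fintype.piFinset fun _ : Fin k => Finset.range γ,
          f (fun j => (w j : ℤ) * (d j : ℤ)) := by
  symm
  have hcancel : ∀ (a b x : ℕ), a * b ≡ 1 [MOD γ] → x < γ → a * (b * x % γ) % γ = x := by
    intro a b x h hx
    have h1 : a * (b * x % γ) ≡ x [MOD γ] := by
      calc a * (b * x % γ) ≡ a * (b * x) [MOD γ] := (Nat.mod_modEq _ _).mul_left a
        _ = (a * b) * x := by ring
        _ ≡ 1 * x [MOD γ] := h.mul_right x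
        _ = x := one_mul x
    rw [h1, Nat.mod_eq_of_lt hx]
  refine Finset.sum_nbij' (fun d j => w j * d j % γ) (fun d j => w' j * d j % γ) ?_ ?_ ?_ ?_ ?_
  · intro d _
    simp [Fintype.mem_piFinset, Nat.mod_lt _ hγ]
  · intro d _
    simp [Fintype.mem_piFinset, Nat.mod_lt _ hγ]
  · intro d hd
    simp only [Fintype.mem_piFinset, Finset.mem_range] at hd
    funext j
    exact hcancel _ _ _ (hw j) (hd j)
  · intro d hd
    simp only [Fintype.mem_piFinset, Finset.mem_range] at hd
    funext j
    exact hcancel _ _ _ (by rw [mul_comm]; exact hw j) (hd j)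
  · intro d _
    rw [← hf (fun j => ((w j * d j % γ : ℕ) : ℤ)) (fun j => ((w j * d j / γ : ℕ) : ℤ))]
    congr 1
    funext j
    have := Nat.mod_add_div (w j * d j) γ
    simp only [Pi.add_apply, Pi.smul_apply, smul_eq_mul]
    exact_mod_cast this.symm

end Periodic

section Primitive

variable {k : ℕ} {A : Matrix (Fin k) (Fin k) ℤ}

/-- `γ ∣ Q_A(d)` and the integers `γ`, `A d`, `Q_A(d)/γ` have no common prime factor. -/
def IsPrimitiveIsotropic (A : Matrix (Fin k) (Fin k) ℤ) (γ : ℕ) (d : Fin k → ℤ) : Prop :=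
  ∃ e : ℤ, d ⬝ᵥ A *ᵥ d = 2 * (γ * e) ∧
    ∀ p : ℕ, p.Prime → (p : ℤ) ∣ γ → (∀ i, (p : ℤ) ∣ (A *ᵥ d) i) → ¬ (p : ℤ) ∣ e

theorem dotProduct_mulVec_swap {R : Type*} [CommRing R] {B : Matrix (Fin k) (Fin k) R}
    (hB : B.IsSymm) (u v : Fin k → R) : u ⬝ᵥ B *ᵥ v = v ⬝ᵥ B *ᵥ u := by
  rw [dotProduct_mulVec, ← mulVec_transpose, hB.eq, dotProduct_comm]

theorem IsPrimitiveIsotropic.add_smul (hA : A.IsSymm) (heven : ∀ v, 2 ∣ v ⬝ᵥ A *ᵥ v)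
    {γ : ℕ} {d : Fin k → ℤ} (h : IsPrimitiveIsotropic A γ d) (v : Fin k → ℤ) :
    IsPrimitiveIsotropic A γ (d + (γ : ℤ) • v) := by
  obtain ⟨e, he, hp⟩ := h
  obtain ⟨q, hq⟩ := heven v
  refine ⟨e + v ⬝ᵥ A *ᵥ d + γ * q, ?_, ?_⟩
  · simp only [mulVec_add, mulVec_smul, dotProduct_add, add_dotProduct, dotProduct_smul,
      smul_dotProduct, smul_eq_mul, he, hq, dotProduct_mulVec_swap hA d v]
    ring
  · intro p hpp hpγ hpd hpe
    have hd : ∀ i, (p : ℤ) ∣ (A *ᵥ d) i := by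
      intro i
      have := hpd i
      simp only [mulVec_add, mulVec_smul, Pi.add_apply, Pi.smul_apply, smul_eq_mul] at this
      exact (dvd_add_left (hpγ.mul_right _)).1 this
    refine hp p hpp hpγ hd ?_
    rw [dvd_add_left (hpγ.mul_right _), dvd_add_left] at hpe
    · exact hpe
    · exact Finset.dvd_sum fun i _ => (hd i).mul_left _

theorem isPrimitiveIsotropic_add_smul_iff (hA : A.IsSymm) (heven : ∀ v, 2 ∣ v ⬝ᵥ A *ᵥ v)
    {γ : ℕ} (d v : Fin k → ℤ) :
    IsPrimitiveIsotropic A γ (d + (γ : ℤ) • v) ↔ IsPrimitiveIsotropic A γ d := by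
  refine ⟨fun h => ?_, fun h => h.add_smul hA heven v⟩
  simpa [add_assoc] using h.add_smul hA heven (-v)

theorem not_dvd_of_coprime {β γ p : ℕ} (hco : Nat.Coprime β γ) (hp : p.Prime)
    (hpγ : (p : ℤ) ∣ γ) : ¬ (p : ℤ) ∣ β := fun h =>
  Nat.not_coprime_of_dvd_of_dvd hp.one_lt (Int.natCast_dvd_natCast.1 h)
    (Int.natCast_dvd_natCast.1 hpγ) hco

theorem isPrimitiveIsotropic_smul_iff (heven : ∀ v, 2 ∣ v ⬝ᵥ A *ᵥ v) {β γ : ℕ}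
    (hγ : 0 < γ) (hco : Nat.Coprime β γ) (d : Fin k → ℤ) :
    IsPrimitiveIsotropic A γ ((β : ℤ) • d) ↔ IsPrimitiveIsotropic A γ d := by
  have hform : ((β : ℤ) • d) ⬝ᵥ A *ᵥ ((β : ℤ) • d) = β ^ 2 * (d ⬝ᵥ A *ᵥ d) := by
    simp only [mulVec_smul, dotProduct_smul, smul_dotProduct, smul_eq_mul]
    ring
  have hprime : ∀ p : ℕ, p.Prime → (p : ℤ) ∣ γ → ∀ x : ℤ, (p : ℤ) ∣ β * x → (p : ℤ) ∣ x :=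
    fun p hp hpγ x hx =>
      ((Nat.prime_iff_prime_int.1 hp).dvd_or_dvd hx).resolve_left (not_dvd_of_coprime hco hp hpγ)
  constructor
  · rintro ⟨e, he, hp⟩
    obtain ⟨q, hq⟩ := heven d
    have h1 : (β : ℤ) ^ 2 * q = γ * e := by
      rw [hform, hq] at he
      linarith
    have hcop : IsCoprime (γ : ℤ) ((β : ℤ) ^ 2) :=
      (Nat.isCoprime_iff_coprime.2 hco.symm).pow_right
    obtain ⟨e', rfl⟩ : (γ : ℤ) ∣ q := hcop.dvd_of_dvd_mul_left ⟨e, h1⟩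
    refine ⟨e', hq, fun p hpp hpγ hpd hpe => ?_⟩
    refine hp p hpp hpγ (fun i => ?_) ?_
    · rw [mulVec_smul]
      exact (hpd i).mul_left (β : ℤ)
    · have : (β : ℤ) ^ 2 * e' = e := by
        apply mul_left_cancel₀ (Int.natCast_ne_zero.2 hγ.ne')
        linarith
      rw [← this]
      exact hpe.mul_left _
  · rintro ⟨e, he, hp⟩
    refine ⟨β ^ 2 * e, by rw [hform, he]; ring, fun p hpp hpγ hpd hpe => ?_⟩
    refine hp p hpp hpγ (fun i => ?_) ?_
    · have := hpd i
      rw [mulVec_smul] at this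
      exact hprime p hpp hpγ _ this
    · refine hprime p hpp hpγ _ (hprime p hpp hpγ _ ?_)
      rwa [← mul_assoc, ← sq]

end Primitive

section Hyperbolic

variable {R : Type} [CommRing R] {m : ℕ}

theorem sum_fin_first_mid_last (f : Fin (m + 2) → R) :
    ∑ i, f i = vfirst f + ∑ i, vmid f i + vlast f := by
  rw [Fin.sum_univ_castSucc, Fin.sum_univ_succ]
  rfl

theorem forall_fin_first_mid_last {P : Fin (m + 2) → Prop} :
    (∀ i, P i) ↔ P ⟨0, by omega⟩ ∧
      (∀ i : Fin m, P ⟨(i : ℕ) + 1, by have := i.isLt; omega⟩) ∧ P ⟨m + 1, by omega⟩ := by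
  refine ⟨fun h => ⟨h _, fun _ => h _, h _⟩, fun ⟨h0, hmid, hlast⟩ i => ?_⟩
  obtain ⟨i, hi⟩ := i
  rcases Nat.eq_zero_or_pos i with rfl | hi0
  · exact h0
  · rcases eq_or_ne i (m + 1) with rfl | him
    · exact hlast
    · obtain ⟨j, rfl⟩ := Nat.exists_eq_add_of_lt hi0
      have := hmid ⟨j, by omega⟩
      simpa using this

theorem hyp_mulVec_first (A : Matrix (Fin m) (Fin m) ℤ) (v : Fin (m + 2) → R) :
    (((hyp A).map (Int.cast : ℤ → R)) *ᵥ v) ⟨0, by omega⟩ = vlast v := by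
  simp only [mulVec, dotProduct, sum_fin_first_mid_last]
  simp [vfirst, vmid, vlast, hyp, fun i : Fin m => i.isLt.ne]

theorem hyp_mulVec_last (A : Matrix (Fin m) (Fin m) ℤ) (v : Fin (m + 2) → R) :
    (((hyp A).map (Int.cast : ℤ → R)) *ᵥ v) ⟨m + 1, by omega⟩ = vfirst v := by
  simp only [mulVec, dotProduct, sum_fin_first_mid_last]
  simp [vfirst, vmid, vlast, hyp]

theorem hyp_mulVec_mid (A : Matrix (Fin m) (Fin m) ℤ) (v : Fin (m + 2) → R) (i : Fin m) :
    (((hyp A).map (Int.cast : ℤ → R)) *ᵥ v) ⟨(i : ℕ) + 1, by have := i.isLt; omega⟩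
      = ((A.map (Int.cast : ℤ → R)) *ᵥ vmid v) i := by
  simp only [mulVec, dotProduct, sum_fin_first_mid_last]
  simp [vfirst, vmid, vlast, hyp, i.isLt.ne, fun i : Fin m => i.isLt.ne]

theorem dotProduct_hyp_mulVec (A : Matrix (Fin m) (Fin m) ℤ) (u v : Fin (m + 2) → R) :
    u ⬝ᵥ ((hyp A).map (Int.cast : ℤ → R)) *ᵥ v
      = vfirst u * vlast v + vmid u ⬝ᵥ (A.map (Int.cast : ℤ → R)) *ᵥ vmid v
        + vlast u * vfirst v := by
  rw [dotProduct, sum_fin_first_mid_last]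
  simp only [vfirst, vmid, vlast, hyp_mulVec_first, hyp_mulVec_last, hyp_mulVec_mid]
  rfl

theorem map_intCast_int {k : ℕ} (A : Matrix (Fin k) (Fin k) ℤ) :
    A.map (Int.cast : ℤ → ℤ) = A := by
  ext
  simp

theorem hyp_isSymm {A : Matrix (Fin m) (Fin m) ℤ} (hA : A.IsSymm) : (hyp A).IsSymm := by
  ext i j
  have := fun a b => hA.apply a b
  simp only [transpose_apply, hyp]
  split_ifs <;> first | rfl | omega | exact this _ _

theorem hyp_even {A : Matrix (Fin m) (Fin m) ℤ} (hA : ∀ v, 2 ∣ v ⬝ᵥ A *ᵥ v)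
    (v : Fin (m + 2) → ℤ) : 2 ∣ v ⬝ᵥ hyp A *ᵥ v := by
  have h := dotProduct_hyp_mulVec A v v
  rw [map_intCast_int, map_intCast_int] at h
  rw [h]
  obtain ⟨q, hq⟩ := hA (vmid v)
  exact ⟨vfirst v * vlast v + q, by rw [hq]; ring⟩

theorem isPrimitiveIsotropic_hyp_scale_iff {A : Matrix (Fin m) (Fin m) ℤ} {γ : ℕ} {a b t : ℤ}
    (hab : a * b = 1 + γ * t) {d d' : Fin (m + 2) → ℤ} (hfirst : vfirst d' = a * vfirst d)
    (hmid : vmid d' = vmid d) (hlast : vlast d' = b * vlast d) :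
    IsPrimitiveIsotropic (hyp A) γ d' ↔ IsPrimitiveIsotropic (hyp A) γ d := by
  have hmulVec : ∀ (p : ℤ) (x : Fin (m + 2) → ℤ), (∀ i, p ∣ (hyp A *ᵥ x) i) ↔
      p ∣ vlast x ∧ (∀ i, p ∣ (A *ᵥ vmid x) i) ∧ p ∣ vfirst x := by
    intro p x
    have h0 := hyp_mulVec_first A x
    have h1 := hyp_mulVec_mid A x
    have h2 := hyp_mulVec_last A x
    rw [map_intCast_int] at h0 h2
    simp only [map_intCast_int] at h1
    rw [forall_fin_first_mid_last, h0, h2]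
    simp only [h1]
  have hform : ∀ x : Fin (m + 2) → ℤ, x ⬝ᵥ hyp A *ᵥ x
      = vfirst x * vlast x + vmid x ⬝ᵥ A *ᵥ vmid x + vlast x * vfirst x := by
    intro x
    simpa only [map_intCast_int] using dotProduct_hyp_mulVec A x x
  have hunit : ∀ p x u v : ℤ, u * v = 1 + γ * t → p ∣ γ → (p ∣ u * x ↔ p ∣ x) := by
    intro p x u v huv hp
    refine ⟨fun h => ?_, fun h => h.mul_left u⟩
    have : x = v * (u * x) - γ * (t * x) := by linear_combination (-x) * huv
    rw [this]
    exact dvd_sub (h.mul_left v) (hp.mul_right _)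
  have hformd : d' ⬝ᵥ hyp A *ᵥ d'
      = d ⬝ᵥ hyp A *ᵥ d + 2 * (γ * (t * (vfirst d * vlast d))) := by
    rw [hform, hform, hfirst, hmid, hlast]
    linear_combination (2 * vfirst d * vlast d) * hab
  rw [IsPrimitiveIsotropic, IsPrimitiveIsotropic,
    ← (Equiv.addRight (t * (vfirst d * vlast d))).exists_congr_right]
  refine exists_congr fun e => and_congr ?_ (forall₃_congr fun p _ hpγ => ?_)
  · rw [hformd, Equiv.coe_addRight, mul_add, mul_add, add_left_inj]
  · rw [hmulVec, hmulVec, hfirst, hmid, hlast, hunit p _ a b hab hpγ,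
      hunit p _ b a (by rw [mul_comm, hab]) hpγ, Equiv.coe_addRight]
    refine forall_congr' fun ⟨_, _, hpd⟩ => not_congr ?_
    exact dvd_add_left ((hpd.mul_right _).mul_left _)

end Hyperbolic

section Coefficients

variable {k : ℕ} {A : Matrix (Fin k) (Fin k) ℤ}

theorem map_mulVec_intCast (A : Matrix (Fin k) (Fin k) ℤ) (d : Fin k → ℤ) (i : Fin k) :
    (A.map (Int.cast : ℤ → ℚ) *ᵥ fun j => (d j : ℚ)) i = ((A *ᵥ d) i : ℤ) := by
  simp [mulVec, dotProduct]

theorem bilin_intCast (A : Matrix (Fin k) (Fin k) ℤ) (d d' : Fin k → ℤ) :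
    bilin ℚ A (fun j => (d j : ℚ)) (fun j => (d' j : ℚ)) = (d ⬝ᵥ A *ᵥ d' : ℤ) := by
  simp [bilin, mulVec, dotProduct]

theorem ratGcd_intCast_eq_one_iff (z : Fin k → ℤ) :
    ratGcd (fun i => (z i : ℚ)) = 1 ↔ ∀ p : ℕ, p.Prime → ¬ ∀ i, (p : ℤ) ∣ z i := by
  rw [Nat.eq_one_iff_not_exists_prime_dvd]
  refine forall₂_congr fun p _ => not_congr ?_
  simp [ratGcd, Finset.dvd_gcd_iff, Int.natCast_dvd]

open scoped Classical in
/-- The summand of the Dirichlet coefficient, as a function on `ℤ^k`. -/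
noncomputable def coefTerm (A : Matrix (Fin k) (Fin k) ℤ) (lam : Fin k → ℚ) (γ : ℕ)
    (d : Fin k → ℤ) : ℂ :=
  if IsPrimitiveIsotropic A γ d then
    Complex.exp (2 * Real.pi * Complex.I *
      ((bilin ℚ A lam (fun j => (d j : ℚ)) / γ : ℚ) : ℂ))
  else 0

theorem coefTerm_congr {lam lam' : Fin k → ℚ} {γ : ℕ} {d d' : Fin k → ℤ}
    (hiff : IsPrimitiveIsotropic A γ d ↔ IsPrimitiveIsotropic A γ d') {z : ℤ}
    (hz : bilin ℚ A lam (fun j => (d j : ℚ)) / γ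
      = bilin ℚ A lam' (fun j => (d' j : ℚ)) / γ + z) :
    coefTerm A lam γ d = coefTerm A lam' γ d' := by
  classical
  refine if_congr hiff ?_ rfl
  rw [hz, Rat.cast_add, mul_add, Complex.exp_add, Rat.cast_intCast,
    mul_comm _ (z : ℂ), Complex.exp_int_mul_two_pi_mul_I, mul_one]

theorem coefTerm_add_smul (hA : A.IsSymm) (heven : ∀ v, 2 ∣ v ⬝ᵥ A *ᵥ v)
    {lam : Fin k → ℚ} (hlam : inDual A lam) {γ : ℕ} (hγ : 0 < γ) (d v : Fin k → ℤ) :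
    coefTerm A lam γ (d + (γ : ℤ) • v) = coefTerm A lam γ d := by
  choose y hy using hlam
  refine coefTerm_congr (isPrimitiveIsotropic_add_smul_iff hA heven d v) (z := v ⬝ᵥ y) ?_
  have hlamv : lam ⬝ᵥ A.map (Int.cast : ℤ → ℚ) *ᵥ (fun j => (v j : ℚ)) = ((v ⬝ᵥ y : ℤ) : ℚ) := by
    rw [dotProduct_mulVec_swap (hA.map _)]
    simp [dotProduct, hy]
  have hcast : (fun j => (((d + (γ : ℤ) • v) j : ℤ) : ℚ))
      = (fun j => (d j : ℚ)) + (γ : ℚ) • fun j => (v j : ℚ) := by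
    funext j
    simp
  have hγ' : (γ : ℚ) ≠ 0 := by positivity
  rw [bilin, bilin, hcast, mulVec_add, mulVec_smul, dotProduct_add, dotProduct_smul, hlamv,
    smul_eq_mul]
  field_simp

theorem gExt_condition_iff (n : ℕ) (S : Matrix (Fin n) (Fin n) ℤ) {γ : ℕ} (hγ : 0 < γ)
    (d : Fin (n + 2) → ℕ) :
    ((∃ e : ℤ, quadF ℚ (MatS0 n S) (fun j => (d j : ℚ)) = (γ : ℚ) * e) ∧
        ratGcd (((MatS1 n S).map (Int.cast : ℤ → ℚ)).mulVec (gExt n S d γ)) = 1) ↔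
      IsPrimitiveIsotropic (MatS0 n S) γ (fun j => (d j : ℤ)) := by
  have hγ' : (γ : ℚ) ≠ 0 := by positivity
  have hquad : ∀ e : ℤ, quadF ℚ (MatS0 n S) (fun j => (d j : ℚ)) = (γ : ℚ) * e ↔
      (fun j => (d j : ℤ)) ⬝ᵥ MatS0 n S *ᵥ (fun j => (d j : ℤ)) = 2 * (γ * e) := by
    intro e
    have := bilin_intCast (MatS0 n S) (fun j => (d j : ℤ)) (fun j => (d j : ℤ))
    simp only [Int.cast_natCast] at this
    rw [quadF, this, div_eq_iff two_ne_zero, mul_comm _ (2 : ℚ)]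
    exact_mod_cast Iff.rfl
  rw [← exists_and_right]
  refine exists_congr fun e => ?_
  rw [← hquad e]
  refine and_congr_right fun he => ?_
  have hmid : vmid (m := n + 2) (gExt n S d γ) = fun j => (((d j : ℕ) : ℤ) : ℚ) := by
    funext i
    simp [vmid, gExt, i.isLt.ne]
  let z : Fin (n + 4) → ℤ := fun i =>
    if (i : ℕ) = 0 then γ else if h : (i : ℕ) = n + 3 then -e
      else (MatS0 n S *ᵥ fun j => (d j : ℤ)) ⟨(i : ℕ) - 1, by omega⟩
  have hz : ((MatS1 n S).map (Int.cast : ℤ → ℚ)).mulVec (gExt n S d γ) = fun i => (z i : ℚ) := by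
    rw [funext_iff]
    refine (forall_fin_first_mid_last (m := n + 2)).2 ⟨?_, fun i => ?_, ?_⟩
    · refine (hyp_mulVec_first _ _).trans ?_
      simp [vlast, gExt, z]
    · refine (hyp_mulVec_mid _ _ i).trans ?_
      rw [hmid, map_mulVec_intCast]
      simp [z, i.isLt.ne]
    · refine (hyp_mulVec_last _ _).trans ?_
      simp only [vfirst, gExt, he, z]
      simp
      field_simp
  rw [hz, ratGcd_intCast_eq_one_iff]
  refine forall₂_congr fun p _ => ?_
  rw [forall_fin_first_mid_last (m := n + 2)]
  have hzmid : ∀ i : Fin (n + 2), z ⟨(i : ℕ) + 1, by omega⟩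
      = (MatS0 n S *ᵥ fun j => (d j : ℤ)) i := by
    intro i
    simp [z, i.isLt.ne]
  have hz0 : z ⟨0, by omega⟩ = γ := by simp [z]
  have hzlast : z ⟨n + 2 + 1, by omega⟩ = -e := by simp [z]
  rw [hz0, hzlast, dvd_neg]
  simp only [hzmid]
  tauto

theorem aCoef_eq_sum_coefTerm (n : ℕ) (S : Matrix (Fin n) (Fin n) ℤ) {γ : ℕ} (hγ : 0 < γ)
    (lam : Fin (n + 2) → ℚ) :
    aCoef n S lam γ = ∑ d ∈ Fintype.piFinset fun _ : Fin (n + 2) => Finset.range γ,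
      coefTerm (MatS0 n S) lam γ (fun j => (d j : ℤ)) := by
  classical
  refine Finset.sum_congr rfl fun d _ => if_congr (gExt_condition_iff n S hγ d) ?_ rfl
  simp only [Int.cast_natCast]

end Coefficients

section AsmVec

variable {n : ℕ} {S : Matrix (Fin n) (Fin n) ℤ}

theorem matS0_isSymm (hS : S.IsSymm) : (MatS0 n S).IsSymm :=
  hyp_isSymm hS.neg

theorem matS0_even (hS : ∀ v : Fin n → ℤ, 2 ∣ v ⬝ᵥ S *ᵥ v) (v : Fin (n + 2) → ℤ) :
    2 ∣ v ⬝ᵥ MatS0 n S *ᵥ v :=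
  hyp_even (fun u => by simpa [neg_mulVec] using hS u) v

theorem vmid_asmVec (l m : ℚ) (μ : Fin n → ℚ) : vmid (asmVec n l μ m) = μ := by
  funext i
  simp [vmid, asmVec, i.isLt.ne]

theorem vfirst_asmVec (l m : ℚ) (μ : Fin n → ℚ) : vfirst (asmVec n l μ m) = l := by
  simp [vfirst, asmVec]

theorem vlast_asmVec (l m : ℚ) (μ : Fin n → ℚ) : vlast (asmVec n l μ m) = m := by
  simp [vlast, asmVec]

theorem inDual_asmVec {μ : Fin n → ℚ} (hμ : inDual S μ) (l m : ℤ) :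
    inDual (MatS0 n S) (asmVec n (l : ℚ) μ (m : ℚ)) := by
  refine forall_fin_first_mid_last.2 ⟨⟨m, ?_⟩, fun i => ?_, ⟨l, ?_⟩⟩
  · exact (hyp_mulVec_first _ _).trans (vlast_asmVec _ _ _)
  · obtain ⟨z, hz⟩ := hμ i
    refine ⟨-z, (hyp_mulVec_mid _ _ i).trans ?_⟩
    rw [vmid_asmVec, Int.cast_neg, ← hz]
    simp [mulVec, dotProduct]
  · exact (hyp_mulVec_last _ _).trans (vfirst_asmVec _ _ _)

/-- Scaling the two isotropic coordinates by mutually inverse units modulo `γ`. -/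
theorem aCoef_asmVec_scale (hS : S.IsSymm) (heven : ∀ v : Fin n → ℤ, 2 ∣ v ⬝ᵥ S *ᵥ v)
    {μ : Fin n → ℚ} (hμ : inDual S μ) (l m : ℤ) {β γ : ℕ} (hγ : 0 < γ)
    (hco : Nat.Coprime β γ) :
    aCoef n S (asmVec n (l : ℚ) μ ((β * m : ℤ) : ℚ)) γ
      = aCoef n S (asmVec n ((β * l : ℤ) : ℚ) μ (m : ℚ)) γ := by
  obtain ⟨β', hβ'⟩ := exists_inverse_mod hγ hco
  obtain ⟨t, ht⟩ : ∃ t : ℤ, (β' : ℤ) * β = 1 + γ * t := by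
    obtain ⟨t, ht⟩ := (Nat.modEq_iff_dvd.1 hβ'.symm)
    push_cast at ht
    exact ⟨t, by linarith⟩
  have hsymm0 := matS0_isSymm hS
  have heven0 := matS0_even heven
  have hperiodic := coefTerm_add_smul hsymm0 heven0 (inDual_asmVec hμ l (β * m)) hγ
  let w (a b : ℕ) (j : Fin (n + 2)) : ℕ :=
    if (j : ℕ) = 0 then a else if (j : ℕ) = n + 1 then b else 1
  have hw : ∀ j, w β β' j * w β' β j ≡ 1 [MOD γ] := by
    intro j
    simp only [w]
    split_ifs
    · rwa [mul_comm]
    · exact hβ'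
    · rfl
  rw [aCoef_eq_sum_coefTerm n S hγ, aCoef_eq_sum_coefTerm n S hγ,
    sum_residues_scale hγ hperiodic hw]
  refine Finset.sum_congr rfl fun d _ => ?_
  have hfirst : ∀ (K : Type) [CommRing K],
      vfirst (fun j => (w β' β j : K) * (d j : K)) = β' * vfirst fun j => (d j : K) := by
    simp [vfirst, w]
  have hmid : ∀ (K : Type) [CommRing K],
      vmid (fun j => (w β' β j : K) * (d j : K)) = vmid fun j => (d j : K) := by
    intro K _
    funext i
    simp [vmid, w, i.isLt.ne]
  have hlast : ∀ (K : Type) [CommRing K],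
      vlast (fun j => (w β' β j : K) * (d j : K)) = β * vlast fun j => (d j : K) := by
    simp [vlast, w]
  refine coefTerm_congr (z := t * m * vfirst fun j => (d j : ℤ))
    (isPrimitiveIsotropic_hyp_scale_iff ht (hfirst ℤ) (hmid ℤ) (hlast ℤ)) ?_
  have hγ' : (γ : ℚ) ≠ 0 := by positivity
  have htq : (β' : ℚ) * β = 1 + γ * t := by exact_mod_cast ht
  have hcast : ((vfirst fun j => (d j : ℤ) : ℤ) : ℚ) = vfirst fun j => (d j : ℚ) := by
    simp [vfirst]
  simp only [bilin, MatS0, dotProduct_hyp_mulVec, vfirst_asmVec, vmid_asmVec, vlast_asmVec,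
    Int.cast_mul, Int.cast_natCast, hfirst ℚ, hmid ℚ, hlast ℚ, hcast]
  field_simp
  linear_combination (m * vfirst fun j => (d j : ℚ)) * htq

theorem aCoef_div (hS : S.IsSymm) (heven : ∀ v : Fin n → ℤ, 2 ∣ v ⬝ᵥ S *ᵥ v)
    {lam : Fin (n + 2) → ℚ} {β γ : ℕ} (hβ : 0 < β) (hγ : 0 < γ) (hco : Nat.Coprime β γ)
    (hlam : inDual (MatS0 n S) (fun i => lam i / β)) :
    aCoef n S lam γ = aCoef n S (fun i => lam i / β) γ := by
  obtain ⟨β', hβ'⟩ := exists_inverse_mod hγ hco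
  have heven0 := matS0_even heven
  have hperiodic := coefTerm_add_smul (matS0_isSymm hS) heven0 hlam hγ
  rw [aCoef_eq_sum_coefTerm n S hγ, aCoef_eq_sum_coefTerm n S hγ,
    sum_residues_scale hγ hperiodic (w := fun _ => β) (w' := fun _ => β') fun _ => hβ']
  refine Finset.sum_congr rfl fun d _ => ?_
  refine coefTerm_congr (z := 0)
    (isPrimitiveIsotropic_smul_iff heven0 hγ hco fun j => (d j : ℤ)).symm ?_
  have hβ0 : (β : ℚ) ≠ 0 := by positivity
  have hleft : (fun i => lam i / β) = (β : ℚ)⁻¹ • lam := by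
    funext i
    simp [div_eq_inv_mul]
  have hright : (fun j => (((β : ℤ) * (d j : ℤ) : ℤ) : ℚ)) = (β : ℚ) • fun j => (d j : ℚ) := by
    funext j
    simp
  rw [hright, hleft]
  simp [bilin, mulVec_smul, hβ0]

end AsmVec

end OEis

open OEis

/-- behaviour of the Dirichlet coefficients under the
substitutions `(l,μ,m) ↦ (βl,μ,m/β)` and `λ ↦ (1/β)λ`, for `β ∣ m`
coprime to `γ`. -/
theorem dirichlet_coeff_beta_invariance
    (n : ℕ) (hn : 1 ≤ n) (S : Matrix (Fin n) (Fin n) ℤ)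
    (hsymm : S.IsSymm)
    (hpos : ∀ v : Fin n → ℝ, v ≠ 0 → 0 < bilin ℝ S v v)
    (heven : ∀ v : Fin n → ℤ, 2 ∣ v ⬝ᵥ S.mulVec v)
    (l : ℤ) (μ : Fin n → ℚ) (hμ : inDual S μ) (m : ℤ)
    (β γ : ℕ) (hβ : 0 < β) (hγ : 0 < γ)
    (hdvd : (β : ℤ) ∣ m) (hco : Nat.Coprime β γ) :
    aCoef n S (asmVec n (l : ℚ) μ (m : ℚ)) γ
      = aCoef n S (asmVec n ((β : ℚ) * l) μ ((m : ℚ) / β)) γ ∧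
    (inDual (MatS0 n S) (fun i => asmVec n (l : ℚ) μ (m : ℚ) i / β) →
      aCoef n S (asmVec n (l : ℚ) μ (m : ℚ)) γ
        = aCoef n S (fun i => asmVec n (l : ℚ) μ (m : ℚ) i / β) γ) := by
  refine ⟨?_, aCoef_div hsymm heven hβ hγ hco⟩
  obtain ⟨m, rfl⟩ := hdvd
  have hβ0 : (β : ℚ) ≠ 0 := by positivity
  have h := aCoef_asmVec_scale hsymm heven hμ l m hγ hco
  rwa [Int.cast_mul (β : ℤ) l, Int.cast_natCast,
    show (m : ℚ) = ((β * m : ℤ) : ℚ) / β by push_cast; field_simp] at h
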